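/- Let f : ℂ → ℂ∪{∞} be a transcendental meromorphic function with at least one pole. Then the classical Julia set (the complement of the Fatou set, where the Fatou set is the set of points having a neighbourhood on which all iterates are defined and form a normal family) equals the set J(f) defined as the closure of O⁻_f(∞) together with all points x outside this closure such that every neighbourhood U_x ⊆ Ĉ \ closure(O⁻_f(∞)) of x satisfies card(Ĉ \ O⁺_f(U_x)) < ∞. -/

import Mathlib

open Filter Topology OnePoint

/-- The iterates of `F` are all defined (never hit `∞`) on `V`. -/
def IterDefinedOn (F : OnePoint ℂ → OnePoint ℂ) (V : Set (OnePoint ℂ)) : Prop :=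
  ∀ z ∈ V, ∀ n : ℕ, F^[n] z ≠ ∞

/-- The family of iterates of `F` is normal on `V`: it is relatively compact in the
space `C(V, Ĉ)` with the compact-open topology. -/
def NormalIteratesOn (F : OnePoint ℂ → OnePoint ℂ) (V : Set (OnePoint ℂ)) : Prop :=
  IsCompact (closure {g : C(↥V, OnePoint ℂ) | ∃ n : ℕ, ∀ z : ↥V, g z = F^[n] ↑z})

/-- The Fatou set: points with an open neighbourhood on which all iterates are defined
and form a normal family. -/
def fatouSet (F : OnePoint ℂ → OnePoint ℂ) : Set (OnePoint ℂ) :=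
  {x | ∃ V : Set (OnePoint ℂ), IsOpen V ∧ x ∈ V ∧ IterDefinedOn F V ∧ NormalIteratesOn F V}

/-- The backward orbit of `∞`. -/
def backOrbitInfty (F : OnePoint ℂ → OnePoint ℂ) : Set (OnePoint ℂ) :=
  ⋃ m : ℕ, F^[m] ⁻¹' {∞}

theorem exists_differentiableOn_log_ball {h : ℂ → ℂ} {c a : ℂ} {r : ℝ} (hr : 0 < r)
    (hd : DifferentiableOn ℂ h (Metric.ball c r)) (h0 : ∀ z ∈ Metric.ball c r, h z ≠ 0)
    (ha : Complex.exp a = h c) :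
    ∃ L : ℂ → ℂ, DifferentiableOn ℂ L (Metric.ball c r) ∧ L c = a ∧
      ∀ z ∈ Metric.ball c r, Complex.exp (L z) = h z := by
  have hq : DifferentiableOn ℂ (fun z => deriv h z / h z) (Metric.ball c r) :=
    (hd.deriv Metric.isOpen_ball).div hd h0
  obtain ⟨P, hP⟩ := hq.isExactOn_ball
  have hc : c ∈ Metric.ball c r := Metric.mem_ball_self hr
  have hL : ∀ z ∈ Metric.ball c r,
      HasDerivAt (fun z => P z - P c + a) (deriv h z / h z) z := fun z hz =>
    ((hP z hz).sub_const _).add_const _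
  refine ⟨fun z => P z - P c + a, fun z hz => (hL z hz).differentiableAt.differentiableWithinAt,
    by simp, fun z hz => ?_⟩
  have key : ∀ w ∈ Metric.ball c r,
      HasDerivAt (fun z => h z * Complex.exp (-(P z - P c + a))) 0 w := by
    intro w hw
    have h1 := (hd.differentiableAt (Metric.isOpen_ball.mem_nhds hw)).hasDerivAt
    refine (h1.mul (hL w hw).neg.cexp).congr_deriv ?_
    rw [mul_neg, mul_neg, mul_left_comm, mul_div_cancel₀ _ (h0 w hw)]
    ring
  have hconst : h z * Complex.exp (-(P z - P c + a)) = h c * Complex.exp (-(P c - P c + a)) := by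
    refine Metric.isOpen_ball.is_const_of_deriv_eq_zero (convex_ball c r).isPreconnected
      (f := fun z => h z * Complex.exp (-(P z - P c + a)))
      (fun w hw => (key w hw).differentiableAt.differentiableWithinAt)
      (fun w hw => (key w hw).deriv) hz hc
  simp only [sub_self, zero_add] at hconst
  rw [← ha, ← Complex.exp_add, add_neg_cancel, Complex.exp_zero, Complex.exp_neg] at hconst
  have := Complex.exp_ne_zero (P z - P c + a)
  field_simp at hconst
  exact hconst.symm

theorem exists_differentiableOn_cos_eq_ball {f : ℂ → ℂ} {c : ℂ} {r : ℝ} (hr : 0 < r)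
    (hd : DifferentiableOn ℂ f (Metric.ball c r)) (h1 : ∀ z ∈ Metric.ball c r, f z ≠ 1)
    (h2 : ∀ z ∈ Metric.ball c r, f z ≠ -1) :
    ∃ G : ℂ → ℂ, DifferentiableOn ℂ G (Metric.ball c r) ∧ ‖G c‖ ≤ 4 + 2 * ‖f c‖ ∧
      ∀ z ∈ Metric.ball c r, Complex.cos (G z) = f z := by
  have hc : c ∈ Metric.ball c r := Metric.mem_ball_self hr
  have hne : ∀ z ∈ Metric.ball c r, 1 - f z ^ 2 ≠ 0 := by
    intro z hz h
    have : (f z - 1) * (f z + 1) = 0 := by linear_combination -h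
    rcases mul_eq_zero.mp this with h | h
    · exact h1 z hz (sub_eq_zero.mp h)
    · exact h2 z hz (eq_neg_of_add_eq_zero_left h)
  obtain ⟨L, hLd, -, hL⟩ := exists_differentiableOn_log_ball hr
    ((differentiableOn_const (1 : ℂ)).sub (hd.pow 2)) hne (Complex.exp_log (hne c hc))
  have hL' : ∀ z ∈ Metric.ball c r, Complex.exp (L z) = 1 - f z ^ 2 := hL
  have hs : ∀ z ∈ Metric.ball c r, Complex.exp (L z / 2) ^ 2 = 1 - f z ^ 2 := by
    intro z hz
    rw [← hL' z hz, ← Complex.exp_nat_mul]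
    congr 1
    push_cast
    ring
  set s : ℂ → ℂ := fun z => Complex.exp (L z / 2) with hsdef
  have hsd : DifferentiableOn ℂ s (Metric.ball c r) := (hLd.div_const 2).cexp
  have hu : ∀ z ∈ Metric.ball c r, (f z + Complex.I * s z) * (f z - Complex.I * s z) = 1 := by
    intro z hz
    have := hs z hz
    linear_combination this - s z ^ 2 * Complex.I_sq
  have hu0 : ∀ z ∈ Metric.ball c r, f z + Complex.I * s z ≠ 0 := by
    intro z hz h
    have := hu z hz
    simp [h] at this
  obtain ⟨M, hMd, hMc, hM⟩ := exists_differentiableOn_log_ball hr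
    (hd.add (hsd.const_mul Complex.I)) hu0 (Complex.exp_log (hu0 c hc))
  refine ⟨fun z => -Complex.I * M z, hMd.const_mul _, ?_, fun z hz => ?_⟩
  · have hnorm : ‖-Complex.I * M c‖ = ‖M c‖ := by simp
    rw [hnorm, hMc]
    change ‖Complex.log (f c + Complex.I * s c)‖ ≤ _
    set u := f c + Complex.I * s c with hudef
    have hsn : ‖s c‖ ≤ 1 + ‖f c‖ := by
      have h3 : ‖s c‖ ^ 2 ≤ 1 + ‖f c‖ ^ 2 := by
        rw [← norm_pow, hs c hc]
        refine (norm_sub_le _ _).trans ?_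
        simp
      nlinarith [norm_nonneg (s c), norm_nonneg (f c)]
    have hun : ‖u‖ ≤ 1 + 2 * ‖f c‖ := by
      refine (norm_add_le _ _).trans ?_
      simp only [norm_mul, Complex.norm_I, one_mul]
      linarith
    have hvn : ‖u‖⁻¹ ≤ 1 + 2 * ‖f c‖ := by
      rw [← norm_inv, inv_eq_of_mul_eq_one_right (hu c hc)]
      refine (norm_sub_le _ _).trans ?_
      simp only [norm_mul, Complex.norm_I, one_mul]
      linarith
    have hupos : 0 < ‖u‖ := norm_pos_iff.mpr (hu0 c hc)
    have hlog : |Real.log ‖u‖| ≤ 2 * ‖f c‖ := by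
      rw [abs_le]
      constructor
      · have := Real.log_le_sub_one_of_pos (inv_pos.mpr hupos)
        rw [Real.log_inv] at this
        linarith
      · have := Real.log_le_sub_one_of_pos hupos
        linarith
    have h4 := Complex.norm_le_abs_re_add_abs_im (Complex.log u)
    rw [Complex.log_re, Complex.log_im] at h4
    have h5 := Complex.abs_arg_le_pi u
    have := Real.pi_le_four
    linarith
  · have hz' := hu z hz
    have : Complex.exp (-M z) = f z - Complex.I * s z := by
      rw [Complex.exp_neg, hM z hz]
      exact inv_eq_of_mul_eq_one_right hz'
    rw [Complex.cos, show -Complex.I * M z * Complex.I = M z by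
      linear_combination -M z * Complex.I_sq, show -(-Complex.I * M z) * Complex.I = -M z by
      linear_combination M z * Complex.I_sq, this, hM z hz]
    simp only [Pi.add_apply, hsdef]
    ring

theorem exists_cos_eq_int_near (w : ℂ) : ∃ v : ℂ, ‖v - w‖ ≤ 4 ∧ ∃ n : ℤ, Complex.cos v = n := by
  have hy : ∃ t : ℝ, |t - w.im| ≤ 2 ∧ ∃ n : ℤ, Real.cosh t = n := by
    have main : ∀ y : ℝ, 0 ≤ y → ∃ t : ℝ, |t - y| ≤ 2 ∧ ∃ n : ℤ, Real.cosh t = n := by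
      intro y hy
      have h1 : Real.cosh y + 1 ≤ Real.cosh (y + 2) := by
        rw [Real.cosh_add]
        have h2 : (2 : ℝ) ≤ Real.cosh 2 := by
          have := Real.cosh_eq 2
          have h3 := Real.add_one_le_exp (1 : ℝ)
          have h4 : Real.exp 2 = Real.exp 1 * Real.exp 1 := by rw [← Real.exp_add]; norm_num
          have h5 := Real.exp_pos (-2 : ℝ)
          nlinarith
        have h3 := Real.one_le_cosh y
        have h4 : 0 ≤ Real.sinh y * Real.sinh 2 :=
          mul_nonneg (Real.sinh_nonneg_iff.mpr hy) (Real.sinh_nonneg_iff.mpr (by norm_num))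
        nlinarith
      have h2 : (⌈Real.cosh y⌉ : ℝ) ∈ Set.Icc (Real.cosh y) (Real.cosh (y + 2)) :=
        ⟨Int.le_ceil _, (Int.ceil_lt_add_one _).le.trans h1⟩
      obtain ⟨t, ht, hte⟩ := intermediate_value_Icc (by linarith : y ≤ y + 2)
        Real.continuous_cosh.continuousOn h2
      exact ⟨t, abs_le.mpr ⟨by linarith [ht.1], by linarith [ht.2]⟩, _, hte⟩
    rcases le_total 0 w.im with h | h
    · exact main _ h
    · obtain ⟨t, ht, n, hn⟩ := main (-w.im) (by linarith)
      refine ⟨-t, ?_, n, by rw [Real.cosh_neg, hn]⟩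
      rw [← abs_neg]
      convert ht using 2
      ring
  obtain ⟨t, ht, n, hn⟩ := hy
  set k := round (w.re / Real.pi) with hk
  refine ⟨(k * Real.pi : ℝ) + t * Complex.I, ?_, ?_⟩
  · refine (Complex.norm_le_abs_re_add_abs_im _).trans ?_
    have h1 := abs_sub_round (w.re / Real.pi)
    have h2 : |(k : ℝ) * Real.pi - w.re| ≤ 2 := by
      have : (k : ℝ) * Real.pi - w.re = -((w.re / Real.pi - round (w.re / Real.pi)) * Real.pi) := by
        rw [sub_mul, div_mul_cancel₀ _ Real.pi_ne_zero]
        ring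
      rw [this, abs_neg, abs_mul, abs_of_pos Real.pi_pos]
      nlinarith [Real.pi_le_four, Real.pi_pos]
    have e1 : ((k * Real.pi : ℝ) + t * Complex.I - w).re = k * Real.pi - w.re := by simp
    have e2 : ((k * Real.pi : ℝ) + t * Complex.I - w).im = t - w.im := by simp
    rw [e1, e2]
    linarith
  · refine ⟨k.negOnePow * n, ?_⟩
    rw [Complex.cos_add, Complex.cos_mul_I, Complex.sin_mul_I, ← Complex.ofReal_cos,
      ← Complex.ofReal_sin, Real.sin_int_mul_pi, ← Complex.ofReal_cosh, hn, Real.cos_int_mul_pi]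
    rcases Int.even_or_odd k with h | h
    · simp [Int.negOnePow_even _ h, h.neg_one_zpow]
    · simp [Int.negOnePow_odd _ h, h.neg_one_zpow]

theorem ball_subset_image_of_norm_deriv_le {G : ℂ → ℂ} {c : ℂ} {R : ℝ} (hR : 0 < R)
    (hd : DifferentiableOn ℂ G (Metric.ball c R)) (h0 : 0 < ‖deriv G c‖)
    (h2 : ∀ z ∈ Metric.ball c R, ‖deriv G z‖ ≤ 2 * ‖deriv G c‖) :
    Metric.ball (G c) (‖deriv G c‖ * R / 24) ⊆ G '' Metric.ball c R := by
  set A := ‖deriv G c‖ with hA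
  have hdd := hd.deriv Metric.isOpen_ball
  have hmaps : Set.MapsTo (deriv G) (Metric.ball c R) (Metric.closedBall (deriv G c) (3 * A)) := by
    intro z hz
    rw [mem_closedBall_iff_norm]
    have := norm_sub_le (deriv G z) (deriv G c)
    linarith [h2 z hz]
  have hsub : Metric.closedBall c (R / 6) ⊆ Metric.ball c R :=
    Metric.closedBall_subset_ball (by linarith)
  have hD : ∀ z ∈ Metric.closedBall c (R / 6), ‖deriv G z - deriv G c‖ ≤ A / 2 := by
    intro z hz
    have h := Complex.dist_le_div_mul_dist_of_mapsTo_ball hdd hmaps (hsub hz)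
    rw [dist_eq_norm] at h
    refine h.trans ?_
    have hz' : dist z c ≤ R / 6 := hz
    calc 3 * A / R * dist z c ≤ 3 * A / R * (R / 6) := by gcongr
      _ = A / 2 := by field_simp; norm_num
  have hsphere : ∀ z ∈ Metric.sphere c (R / 6), A * R / 12 ≤ ‖G z - G c‖ := by
    intro z hz
    have hzc : ‖z - c‖ = R / 6 := by rwa [mem_sphere_iff_norm] at hz
    have hmv := (convex_closedBall c (R / 6)).norm_image_sub_le_of_norm_hasDerivWithin_le
      (f := fun z => G z - deriv G c * z) (f' := fun z => deriv G z - deriv G c) (C := A / 2)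
      (fun x hx => by
        have h1 := (hd.differentiableAt (Metric.isOpen_ball.mem_nhds (hsub hx))).hasDerivAt
        have h2 := (hasDerivAt_id x).const_mul (deriv G c)
        rw [mul_one] at h2
        exact (h1.sub h2).hasDerivWithinAt)
      hD (Metric.mem_closedBall_self (by positivity)) (Metric.sphere_subset_closedBall hz)
    have e : G z - deriv G c * z - (G c - deriv G c * c) = (G z - G c) - deriv G c * (z - c) := by
      ring
    rw [e, hzc] at hmv
    have h3 := norm_sub_norm_le (deriv G c * (z - c)) (G z - G c)
    rw [norm_sub_rev (deriv G c * (z - c)), norm_mul, hzc, ← hA] at h3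
    linarith
  have hcont : DiffContOnCl ℂ G (Metric.ball c (R / 6)) := hd.diffContOnCl_ball hsub
  have hfreq : ∃ᶠ z in 𝓝 c, G z ≠ G c := by
    intro h
    have h' : G =ᶠ[𝓝 c] fun _ => G c := by
      filter_upwards [h] with z hz using not_not.mp hz
    rw [hA, h'.deriv_eq] at h0
    simp at h0
  have := hcont.ball_subset_image_closedBall (by positivity) hsphere hfreq
  rw [show A * R / 12 / 2 = A * R / 24 by ring] at this
  exact this.trans (Set.image_mono hsub)

theorem norm_deriv_mul_le_of_omits_net {G : ℂ → ℂ} {c : ℂ} {R : ℝ} (hR : 0 < R)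
    (hd : DifferentiableOn ℂ G (Metric.ball c R))
    (hG : ∀ w : ℂ, ∃ v, ‖v - w‖ ≤ 4 ∧ ∀ z ∈ Metric.ball c R, G z ≠ v) :
    ‖deriv G c‖ * R ≤ 384 := by
  have hsub : Metric.closedBall c (R / 2) ⊆ Metric.ball c R :=
    Metric.closedBall_subset_ball (by linarith)
  have hcont : ContinuousOn (fun z => (R / 2 - ‖z - c‖) * ‖deriv G z‖)
      (Metric.closedBall c (R / 2)) :=
    (Continuous.continuousOn (by fun_prop)).mul
      ((hd.deriv Metric.isOpen_ball).continuousOn.mono hsub).norm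
  obtain ⟨p, hp, hmax⟩ := (isCompact_closedBall c (R / 2)).exists_isMaxOn
    ⟨c, Metric.mem_closedBall_self (by positivity)⟩ hcont
  have hmax' : ∀ z ∈ Metric.closedBall c (R / 2),
      (R / 2 - ‖z - c‖) * ‖deriv G z‖ ≤ (R / 2 - ‖p - c‖) * ‖deriv G p‖ := fun z hz => hmax hz
  have hc := hmax' c (Metric.mem_closedBall_self (by positivity))
  rw [sub_self, norm_zero, sub_zero] at hc
  rw [mem_closedBall_iff_norm] at hp
  suffices (R / 2 - ‖p - c‖) * ‖deriv G p‖ ≤ 192 by nlinarith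
  by_contra! hlt
  have hδ : 0 < R / 2 - ‖p - c‖ := by
    by_contra! h
    nlinarith [norm_nonneg (deriv G p)]
  have hA : 0 < ‖deriv G p‖ := by
    by_contra! h
    nlinarith
  set δ := (R / 2 - ‖p - c‖) / 2 with hδdef
  have hin : ∀ z ∈ Metric.ball p δ, δ ≤ R / 2 - ‖z - c‖ := by
    intro z hz
    rw [mem_ball_iff_norm] at hz
    have := norm_sub_le_norm_sub_add_norm_sub z p c
    linarith
  have hsub2 : Metric.ball p δ ⊆ Metric.closedBall c (R / 2) := by
    intro z hz
    rw [mem_closedBall_iff_norm]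
    linarith [hin z hz]
  have key := ball_subset_image_of_norm_deriv_le (R := δ) (by positivity)
    (hd.mono (hsub2.trans hsub)) hA (fun z hz => by
      have h1 := hmax' z (hsub2 hz)
      have h2 := hin z hz
      have h3 : δ * ‖deriv G z‖ ≤ δ * (2 * ‖deriv G p‖) := by
        calc δ * ‖deriv G z‖ ≤ (R / 2 - ‖z - c‖) * ‖deriv G z‖ := by gcongr
          _ ≤ _ := h1
          _ = δ * (2 * ‖deriv G p‖) := by rw [hδdef]; ring
      exact le_of_mul_le_mul_left h3 (by positivity))
  obtain ⟨v, hv, hv'⟩ := hG (G p)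
  obtain ⟨z, hz, hzv⟩ := key (a := v) (by
    rw [mem_ball_iff_norm]
    have : 4 < ‖deriv G p‖ * δ / 24 := by
      rw [hδdef]
      linarith
    linarith)
  exact hv' z (hsub (hsub2 hz)) hzv

theorem norm_cos_le_exp_norm (z : ℂ) : ‖Complex.cos z‖ ≤ Real.exp ‖z‖ := by
  rw [Complex.cos, norm_div, Complex.norm_ofNat, div_le_iff₀ two_pos]
  refine (norm_add_le _ _).trans ?_
  have h1 := Complex.norm_exp_le_exp_norm (z * Complex.I)
  have h2 := Complex.norm_exp_le_exp_norm (-z * Complex.I)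
  simp only [norm_mul, norm_neg, Complex.norm_I, mul_one] at h1 h2
  linarith

/-- **Schottky's theorem**. -/
theorem exists_schottky_bound (M : ℝ) : ∃ C : ℝ, ∀ (f : ℂ → ℂ) (c : ℂ) (R : ℝ),
    DifferentiableOn ℂ f (Metric.ball c R) → (∀ z ∈ Metric.ball c R, f z ≠ 0) →
    (∀ z ∈ Metric.ball c R, f z ≠ 1) → ‖f c‖ ≤ M → ∀ z ∈ Metric.ball c (R / 2), ‖f z‖ ≤ C := by
  refine ⟨1 + Real.exp (4 * Real.exp (4 + 2 * (6 + 4 * M) + 384)), ?_⟩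
  intro f c R hd h0 h1 hM z hz
  have hR : 0 < R := by
    have := Metric.pos_of_mem_ball hz
    linarith
  have hc : c ∈ Metric.ball c R := Metric.mem_ball_self hR
  have hzR : z ∈ Metric.ball c R := Metric.ball_subset_ball (by linarith) hz
  obtain ⟨F, hFd, hFc, hF⟩ := exists_differentiableOn_cos_eq_ball (f := fun z => 2 * f z - 1) hR
    ((hd.const_mul 2).sub_const 1)
    (fun z hz h => h1 z hz (by linear_combination h / 2))
    (fun z hz h => h0 z hz (by linear_combination h / 2))
  have hFn : ∀ z ∈ Metric.ball c R, ∀ n : ℤ, F z ≠ n * Real.pi := by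
    intro z hz n h
    have h2 := hF z hz
    rw [h] at h2
    have h3 : Complex.sin (n * Real.pi) = 0 := Complex.sin_int_mul_pi n
    have h4 := Complex.sin_sq_add_cos_sq (n * Real.pi)
    rw [h3, h2] at h4
    have h5 : f z * (f z - 1) = 0 := by linear_combination h4 / 4
    rcases mul_eq_zero.mp h5 with h | h
    · exact h0 z hz h
    · exact h1 z hz (sub_eq_zero.mp h)
  have hpi : (Real.pi : ℂ) ≠ 0 := by exact_mod_cast Real.pi_ne_zero
  have hFn' : ∀ z ∈ Metric.ball c R, ∀ n : ℤ, F z / Real.pi ≠ n := by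
    intro z hz n h
    exact hFn z hz n (by rw [← h, div_mul_cancel₀ _ hpi])
  obtain ⟨G, hGd, hGc, hG⟩ := exists_differentiableOn_cos_eq_ball (f := fun z => F z / Real.pi) hR
    (hFd.div_const _) (fun z hz => by simpa using hFn' z hz 1)
    (fun z hz => by simpa using hFn' z hz (-1))
  have homit : ∀ w : ℂ, ∃ v, ‖v - w‖ ≤ 4 ∧ ∀ z ∈ Metric.ball c R, G z ≠ v := by
    intro w
    obtain ⟨v, hv, n, hn⟩ := exists_cos_eq_int_near w
    refine ⟨v, hv, fun z hz h => hFn' z hz n ?_⟩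
    rw [← hG z hz, h, hn]
  have hGderiv : ∀ w ∈ Metric.ball c (R / 2), ‖deriv G w‖ ≤ 768 / R := by
    intro w hw
    have hs : Metric.ball w (R / 2) ⊆ Metric.ball c R := by
      refine Metric.ball_subset_ball' ?_
      rw [Metric.mem_ball] at hw
      linarith
    have := norm_deriv_mul_le_of_omits_net (by linarith : 0 < R / 2) (hGd.mono hs) (fun w => by
      obtain ⟨v, hv, hv'⟩ := homit w
      exact ⟨v, hv, fun z hz => hv' z (hs hz)⟩)
    rw [le_div_iff₀ hR]
    linarith
  have hGz : ‖G z - G c‖ ≤ 384 := by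
    have h := (convex_ball c (R / 2)).norm_image_sub_le_of_norm_deriv_le (f := G) (C := 768 / R)
      (fun w hw => hGd.differentiableAt (Metric.isOpen_ball.mem_nhds
        (Metric.ball_subset_ball (by linarith) hw))) hGderiv
      (Metric.mem_ball_self (by linarith)) hz
    refine h.trans ?_
    rw [mem_ball_iff_norm] at hz
    calc 768 / R * ‖z - c‖ ≤ 768 / R * (R / 2) := by gcongr
      _ = 384 := by field_simp; norm_num
  have hf1 : ‖F c‖ ≤ 6 + 4 * M := by
    have := norm_sub_le (2 * f c) 1
    simp only [norm_mul, Complex.norm_ofNat, norm_one] at this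
    linarith
  have hpi1 : (1 : ℝ) ≤ Real.pi := by linarith [Real.pi_gt_three]
  have hG1 : ‖G c‖ ≤ 4 + 2 * (6 + 4 * M) := by
    have : ‖F c / Real.pi‖ ≤ ‖F c‖ := by
      rw [norm_div, Complex.norm_real, Real.norm_of_nonneg Real.pi_pos.le]
      exact div_le_self (norm_nonneg _) hpi1
    linarith
  have hG2 : ‖G z‖ ≤ 4 + 2 * (6 + 4 * M) + 384 := by
    have := norm_le_norm_add_norm_sub' (G z) (G c)
    linarith
  have hF2 : ‖F z‖ ≤ 4 * Real.exp (4 + 2 * (6 + 4 * M) + 384) := by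
    have h2 : F z = Complex.cos (G z) * Real.pi := by
      rw [hG z hzR, div_mul_cancel₀ _ hpi]
    rw [h2, norm_mul, Complex.norm_real, Real.norm_of_nonneg Real.pi_pos.le, mul_comm]
    have h3 := (norm_cos_le_exp_norm (G z)).trans (Real.exp_le_exp.mpr hG2)
    exact mul_le_mul Real.pi_le_four h3 (norm_nonneg _) (by norm_num)
  have h3 := (norm_cos_le_exp_norm (F z)).trans (Real.exp_le_exp.mpr hF2)
  rw [hF z hzR] at h3
  have h4 := norm_le_norm_sub_add (2 * f z) 1
  simp only [norm_mul, Complex.norm_ofNat, norm_one] at h4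
  linarith [norm_nonneg (2 * f z - 1)]

theorem norm_le_of_frequently_norm_le_of_omits {f : ℂ → ℂ} {R M : ℝ}
    (hd : ∀ z, R < ‖z‖ → DifferentiableAt ℂ f z) (h0 : ∀ z, R < ‖z‖ → f z ≠ 0)
    (h1 : ∀ z, R < ‖z‖ → f z ≠ 1) (hM : ∃ᶠ z in cocompact ℂ, ‖f z‖ ≤ M) :
    ∃ C, ∀ᶠ z in cocompact ℂ, ‖f z‖ ≤ C := by
  obtain ⟨C, hC⟩ := exists_schottky_bound M
  have hfreq : ∀ r : ℝ, ∃ z, r < ‖z‖ ∧ ‖f z‖ ≤ M := fun r =>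
    ((hM.and_eventually ((tendsto_norm_cocompact_atTop (E := ℂ)).eventually_gt_atTop r)).exists).imp
      fun z hz => ⟨hz.2, hz.1⟩
  set S := max R 1 * Real.exp 16 with hS
  have hR1 : 0 < max R 1 := lt_max_of_lt_right one_pos
  have hS0 : 0 < S := by positivity
  have hRS : R ≤ S := by
    have : (1 : ℝ) ≤ Real.exp 16 := Real.one_le_exp (by norm_num)
    nlinarith [le_max_left R 1]
  have hcircle : ∀ p, S < ‖p‖ → ‖f p‖ ≤ M → ∀ z, ‖z‖ = ‖p‖ → ‖f z‖ ≤ C := by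
    intro p hp hfp z hz
    have hp0 : p ≠ 0 := norm_pos_iff.mp (hS0.trans hp)
    have hz0 : z ≠ 0 := norm_pos_iff.mp (hz ▸ hS0.trans hp)
    have hbig : ∀ w ∈ Metric.ball (Complex.log p) 16, R < ‖Complex.exp w‖ := by
      intro w hw
      rw [mem_ball_iff_norm] at hw
      have h2 := (Complex.abs_re_le_norm _).trans_lt hw
      rw [Complex.sub_re, Complex.log_re, abs_lt] at h2
      rw [Complex.norm_exp]
      have h3 : Real.log (max R 1) + 16 < Real.log ‖p‖ := by
        have := Real.log_lt_log hS0 hp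
        rwa [hS, Real.log_mul hR1.ne' (Real.exp_pos _).ne', Real.log_exp] at this
      calc R ≤ max R 1 := le_max_left _ _
        _ = Real.exp (Real.log (max R 1)) := (Real.exp_log hR1).symm
        _ < Real.exp w.re := Real.exp_lt_exp.mpr (by linarith [h2.1])
    have key := hC (fun w => f (Complex.exp w)) (Complex.log p) 16
      (fun w hw => ((hd _ (hbig w hw)).comp w
        Complex.differentiableAt_exp).differentiableWithinAt)
      (fun w hw => h0 _ (hbig w hw)) (fun w hw => h1 _ (hbig w hw))
      (by rwa [Complex.exp_log hp0]) (Complex.log z) (by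
        rw [mem_ball_iff_norm]
        refine (Complex.norm_le_abs_re_add_abs_im _).trans_lt ?_
        rw [Complex.sub_re, Complex.sub_im, Complex.log_re, Complex.log_re, hz, sub_self, abs_zero,
          Complex.log_im, Complex.log_im, zero_add]
        have e1 := Complex.abs_arg_le_pi p
        have e2 := Complex.abs_arg_le_pi z
        have e3 := abs_sub (Complex.arg z) (Complex.arg p)
        have e4 := Real.pi_lt_d2
        linarith)
    rwa [Complex.exp_log hz0] at key
  obtain ⟨p, hp, hfp⟩ := hfreq S
  refine ⟨C, ?_⟩
  filter_upwards [(tendsto_norm_cocompact_atTop (E := ℂ)).eventually_gt_atTop ‖p‖] with z hz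
  obtain ⟨q, hq, hfq⟩ := hfreq ‖z‖
  set U : Set ℂ := {w | ‖p‖ < ‖w‖} ∩ {w | ‖w‖ < ‖q‖} with hU
  have hclos : closure U ⊆ {w | ‖p‖ ≤ ‖w‖} ∩ {w | ‖w‖ ≤ ‖q‖} :=
    closure_minimal (fun w hw => show ‖p‖ ≤ ‖w‖ ∧ ‖w‖ ≤ ‖q‖ from ⟨le_of_lt hw.1, le_of_lt hw.2⟩)
      ((isClosed_le continuous_const continuous_norm).inter
        (isClosed_le continuous_norm continuous_const))
  have hopen : IsOpen U := (isOpen_lt continuous_const continuous_norm).inter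
        (isOpen_lt continuous_norm continuous_const)
  have hbdd : Bornology.IsBounded U :=
    Metric.isBounded_ball.subset (s := U) (t := Metric.ball 0 ‖q‖) fun w hw => by simpa using hw.2
  have hdiff : DiffContOnCl ℂ f U := DifferentiableOn.diffContOnCl fun w hw =>
    (hd w (hRS.trans_lt (hp.trans_le (hclos hw).1))).differentiableWithinAt
  refine Complex.norm_le_of_forall_mem_frontier_norm_le hbdd hdiff (fun w hw => ?_)
    (subset_closure (show z ∈ U from ⟨hz, hq⟩))
  rw [hopen.frontier_eq] at hw
  obtain ⟨hw1, hw2⟩ := hw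
  have hw3 : ‖p‖ ≤ ‖w‖ ∧ ‖w‖ ≤ ‖q‖ := hclos hw1
  rcases hw3.1.lt_or_eq with h | h
  · rcases hw3.2.lt_or_eq with h' | h'
    · exact absurd ⟨h, h'⟩ hw2
    · exact hcircle q (hp.trans (hz.trans hq)) hfq w h'
  · exact hcircle p hp hfp w h.symm

theorem exists_tendsto_cocompact_of_isLittleO {f : ℂ → ℂ} {R : ℝ}
    (hd : ∀ z, R < ‖z‖ → DifferentiableAt ℂ f z) (ho : f =o[cocompact ℂ] (id : ℂ → ℂ)) :
    ∃ L : ℂ, Tendsto f (cocompact ℂ) (𝓝 L) := by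
  have hinv : Tendsto (fun w : ℂ => w⁻¹) (𝓝[≠] 0) (cocompact ℂ) := by
    rw [← Metric.cobounded_eq_cocompact]
    exact tendsto_inv₀_nhdsNE_zero
  have hinv' : Tendsto (fun w : ℂ => w⁻¹) (cocompact ℂ) (𝓝[≠] 0) := by
    rw [← Metric.cobounded_eq_cocompact]
    exact tendsto_inv₀_cobounded'
  have hd' : ∀ᶠ w in 𝓝[≠] (0 : ℂ), DifferentiableAt ℂ (fun w => f w⁻¹) w := by
    filter_upwards [hinv.eventually
      ((tendsto_norm_cocompact_atTop (E := ℂ)).eventually_gt_atTop R), self_mem_nhdsWithin]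
      with w hw hw0
    exact (hd _ hw).comp w (differentiableAt_inv hw0)
  have ho' : (fun w => f w⁻¹ - f (0 : ℂ)⁻¹) =o[𝓝[≠] (0 : ℂ)] fun w => (w - 0)⁻¹ := by
    simp only [sub_zero]
    refine (ho.comp_tendsto hinv).sub ?_
    refine Asymptotics.isLittleO_const_left.mpr (Or.inr ?_)
    exact tendsto_norm_cocompact_atTop.comp hinv
  have := Complex.tendsto_limUnder_of_differentiable_on_punctured_nhds_of_isLittleO hd' ho'
  refine ⟨_, (this.comp hinv').congr fun z => ?_⟩
  simp

/-- **Great Picard theorem** at infinity. -/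
theorem exists_tendsto_onePoint_of_omits {f : ℂ → ℂ} {a b : ℂ} (hab : a ≠ b)
    (hd : ∀ᶠ z in cocompact ℂ, DifferentiableAt ℂ f z) (ha : ∀ᶠ z in cocompact ℂ, f z ≠ a)
    (hb : ∀ᶠ z in cocompact ℂ, f z ≠ b) :
    ∃ L : OnePoint ℂ, Tendsto (fun z => (f z : OnePoint ℂ)) (cocompact ℂ) (𝓝 L) := by
  have hba : b - a ≠ 0 := sub_ne_zero.mpr hab.symm
  have hev := (hd.and (ha.and hb))
  rw [← Metric.cobounded_eq_cocompact, ← comap_norm_atTop, eventually_comap] at hev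
  obtain ⟨R, hR⟩ := (hev.and (eventually_ge_atTop 0)).exists_forall_of_atTop
  have hR' : ∀ z : ℂ, R < ‖z‖ → DifferentiableAt ℂ f z ∧ f z ≠ a ∧ f z ≠ b :=
    fun z hz => (hR _ hz.le).1 z rfl
  by_cases hM : ∃ M, ∃ᶠ z in cocompact ℂ, ‖f z‖ ≤ M
  · obtain ⟨M, hM⟩ := hM
    obtain ⟨C, hC⟩ := norm_le_of_frequently_norm_le_of_omits (f := fun z => (f z - a) / (b - a))
      (R := R) (M := (M + ‖a‖) / ‖b - a‖)
      (fun z hz => ((hR' z hz).1.sub_const a).div_const _)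
      (fun z hz => div_ne_zero (sub_ne_zero.mpr (hR' z hz).2.1) hba)
      (fun z hz h => (hR' z hz).2.2 (by
        rw [div_eq_one_iff_eq hba] at h
        exact sub_left_injective h))
      (hM.mono fun z hz => by
        rw [norm_div]
        gcongr
        exact (norm_sub_le _ _).trans (by linarith))
    have hO : f =O[cocompact ℂ] fun _ => (1 : ℂ) := by
      refine Asymptotics.IsBigO.of_bound (C * ‖b - a‖ + ‖a‖) ?_
      filter_upwards [hC] with z hz
      rw [norm_div, div_le_iff₀ (norm_pos_iff.mpr hba)] at hz
      have := norm_le_norm_sub_add (f z) a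
      simp only [norm_one, mul_one]
      linarith
    have ho : f =o[cocompact ℂ] (id : ℂ → ℂ) :=
      hO.trans_isLittleO (Asymptotics.isLittleO_const_left.mpr
        (Or.inr tendsto_norm_cocompact_atTop))
    obtain ⟨L, hL⟩ := exists_tendsto_cocompact_of_isLittleO (fun z hz => (hR' z hz).1) ho
    exact ⟨L, (OnePoint.continuous_coe.tendsto L).comp hL⟩
  · refine ⟨∞, ?_⟩
    have h2 : Tendsto f (cocompact ℂ) (cocompact ℂ) := by
      rw [← Metric.cobounded_eq_cocompact, ← tendsto_norm_atTop_iff_cobounded,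
        tendsto_atTop]
      intro M
      push Not at hM
      rw [Metric.cobounded_eq_cocompact]
      filter_upwards [hM M] with z hz using hz.le
    rw [← coclosedCompact_eq_cocompact] at h2 ⊢
    exact OnePoint.tendsto_coe_infty.comp h2

/-- The uniform structure of the Riemann sphere. -/
@[reducible] noncomputable def sphereUniformSpace : UniformSpace (OnePoint ℂ) :=
  uniformSpaceOfCompactR1

section Sphere

attribute [local instance] sphereUniformSpace

theorem equicontinuousAt_of_forall_norm_le {ι : Type*} {u : ι → ℂ → ℂ} {c : ℂ} {r C : ℝ}
    (hr : 0 < r) (hd : ∀ i, DifferentiableOn ℂ (u i) (Metric.ball c r))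
    (hC : ∀ i, ∀ z ∈ Metric.ball c r, ‖u i z‖ ≤ C) : EquicontinuousAt u c := by
  refine Metric.equicontinuousAt_of_continuity_modulus (fun z => 2 * C / r * dist z c) ?_ u ?_
  · have : Continuous fun z : ℂ => 2 * C / r * dist z c := by fun_prop
    simpa using this.tendsto c
  · filter_upwards [Metric.ball_mem_nhds c hr] with z hz i
    rw [dist_comm]
    refine Complex.dist_le_div_mul_dist_of_mapsTo_ball (hd i) (fun w hw => ?_) hz
    rw [mem_closedBall_iff_norm]
    calc ‖u i w - u i c‖ ≤ ‖u i w‖ + ‖u i c‖ := norm_sub_le _ _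
      _ ≤ 2 * C := by linarith [hC i w hw, hC i c (Metric.mem_ball_self hr)]

theorem equicontinuousOn_of_forall_norm_le {ι : Type*} {u : ι → ℂ → ℂ} {c : ℂ} {r C : ℝ}
    (hd : ∀ i, DifferentiableOn ℂ (u i) (Metric.ball c r))
    (hC : ∀ i, ∀ z ∈ Metric.ball c r, ‖u i z‖ ≤ C) : EquicontinuousOn u (Metric.ball c r) := by
  intro z hz
  obtain ⟨ρ, hρ, hsub⟩ := Metric.isOpen_iff.1 Metric.isOpen_ball z hz
  exact (equicontinuousAt_of_forall_norm_le hρ (fun i => (hd i).mono hsub)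
    fun i w hw => hC i w (hsub hw)).equicontinuousWithinAt _

theorem differentiableOn_of_tendsto_of_forall_norm_le {ι : Type*} {l : Filter ι} [l.NeBot]
    {u : ι → ℂ → ℂ} {v : ℂ → ℂ} {c : ℂ} {r C : ℝ}
    (hd : ∀ i, DifferentiableOn ℂ (u i) (Metric.ball c r))
    (hC : ∀ i, ∀ z ∈ Metric.ball c r, ‖u i z‖ ≤ C)
    (hv : ∀ z ∈ Metric.ball c r, Tendsto (fun i => u i z) l (𝓝 (v z))) :
    DifferentiableOn ℂ v (Metric.ball c r) := by
  have heq := equicontinuousOn_of_forall_norm_le hd hC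
  set 𝔖 : Set (Set ℂ) := {K | IsCompact K ∧ K ⊆ Metric.ball c r} with h𝔖
  have key := (EquicontinuousOn.tendsto_uniformOnFun_iff_pi' (𝔖 := 𝔖) (fun K hK => hK.1)
    (fun K hK => heq.mono hK.2) l v).2 (by
      rw [tendsto_pi_nhds]
      rintro ⟨z, K, hK, hz⟩
      exact hv z (hK.2 hz))
  rw [UniformOnFun.tendsto_iff_tendstoUniformlyOn] at key
  have hloc : TendstoLocallyUniformlyOn u v l (Metric.ball c r) := by
    rw [tendstoLocallyUniformlyOn_iff_forall_isCompact Metric.isOpen_ball]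
    intro K hK hKc
    exact key K ⟨hKc, hK⟩
  exact hloc.differentiableOn (Eventually.of_forall hd) Metric.isOpen_ball

theorem continuous_update_coe_div (a b : ℂ) (hab : a ≠ b) :
    Continuous (Function.update (fun w : ℂ => ((a + (b - a) / w : ℂ) : OnePoint ℂ)) 0 ∞) := by
  rw [continuous_iff_continuousAt]
  intro w
  by_cases hw : w = 0
  · subst hw
    rw [continuousAt_update_same]
    have h1 : Tendsto (fun w : ℂ => a + (b - a) / w) (𝓝[≠] 0) (Bornology.cobounded ℂ) := by
      simp only [div_eq_mul_inv]
      refine (tendsto_const_add_cobounded a).comp ?_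
      exact (tendsto_mul_left_cobounded (sub_ne_zero.2 hab.symm)).comp tendsto_inv₀_nhdsNE_zero
    rw [Metric.cobounded_eq_cocompact, ← coclosedCompact_eq_cocompact] at h1
    exact OnePoint.tendsto_coe_infty.comp h1
  · rw [continuousAt_update_of_ne hw]
    refine OnePoint.continuous_coe.continuousAt.comp ?_
    exact continuousAt_const.add (continuousAt_const.div continuousAt_id hw)

/-- Montel's theorem: a family of holomorphic functions omitting two values is equicontinuous for
the spherical uniform structure. -/
theorem equicontinuousAt_coe_of_omits {ι : Type*} {h : ι → ℂ → ℂ} {c a b : ℂ} {r : ℝ} (hr : 0 < r)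
    (hab : a ≠ b) (hd : ∀ i, DifferentiableOn ℂ (h i) (Metric.ball c r))
    (ha : ∀ i, ∀ z ∈ Metric.ball c r, h i z ≠ a) (hb : ∀ i, ∀ z ∈ Metric.ball c r, h i z ≠ b) :
    EquicontinuousAt (fun i w => (h i w : OnePoint ℂ)) c := by
  obtain ⟨C, hC⟩ := exists_schottky_bound 1
  have hba : b - a ≠ 0 := sub_ne_zero.2 hab.symm
  set q : ι → ℂ → ℂ := fun i w => (h i w - a) / (b - a) with hq
  have hqd : ∀ i, DifferentiableOn ℂ (q i) (Metric.ball c r) := fun i =>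
    ((hd i).sub_const a).div_const _
  have hq0 : ∀ i, ∀ z ∈ Metric.ball c r, q i z ≠ 0 := fun i z hz =>
    div_ne_zero (sub_ne_zero.2 (ha i z hz)) hba
  have hq1 : ∀ i, ∀ z ∈ Metric.ball c r, q i z ≠ 1 := fun i z hz heq => by
    rw [hq] at heq
    simp only [div_eq_one_iff_eq hba, sub_left_inj] at heq
    exact hb i z hz heq
  classical
  set u : ι → ℂ → ℂ := fun i => if ‖q i c‖ ≤ 1 then q i else fun w => (q i w)⁻¹ with hu
  have hud : ∀ i, DifferentiableOn ℂ (u i) (Metric.ball c r) := by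
    intro i
    by_cases hi : ‖q i c‖ ≤ 1
    · simpa only [hu, hi, if_true] using hqd i
    · simp only [hu, hi, if_false]
      exact (hqd i).fun_inv (hq0 i)
  have huC : ∀ i, ∀ z ∈ Metric.ball c (r / 2), ‖u i z‖ ≤ C := by
    intro i
    refine hC (u i) c r (hud i) ?_ ?_ ?_
    · intro z hz
      by_cases hi : ‖q i c‖ ≤ 1
      · simpa only [hu, hi, if_true] using hq0 i z hz
      · simpa only [hu, hi, if_false] using inv_ne_zero (hq0 i z hz)
    · intro z hz
      by_cases hi : ‖q i c‖ ≤ 1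
      · simpa only [hu, hi, if_true] using hq1 i z hz
      · simpa only [hu, hi, if_false, ne_eq, inv_eq_one] using hq1 i z hz
    · by_cases hi : ‖q i c‖ ≤ 1
      · simp only [hu, hi, if_true]
      · simp only [hu, hi, if_false, norm_inv]
        exact inv_le_one_of_one_le₀ (not_le.1 hi).le
  have hsub : Metric.ball c (r / 2) ⊆ Metric.ball c r := Metric.ball_subset_ball (by linarith)
  have hue : EquicontinuousAt u c :=
    equicontinuousAt_of_forall_norm_le (half_pos hr) (fun i => (hud i).mono hsub) huC
  have hT0 : Continuous fun w : ℂ => ((a + (b - a) * w : ℂ) : OnePoint ℂ) :=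
    OnePoint.continuous_coe.comp (by fun_prop)
  have hT1 := continuous_update_coe_div a b hab
  have hK := isCompact_closedBall (0 : ℂ) C
  have hU0 := hK.uniformContinuousOn_of_continuous hT0.continuousOn
  have hU1 := hK.uniformContinuousOn_of_continuous hT1.continuousOn
  intro W hW
  have h0 := hU0 hW
  have h1 := hU1 hW
  rw [mem_map, mem_inf_principal] at h0 h1
  filter_upwards [hue _ h0, hue _ h1, Metric.ball_mem_nhds c (half_pos hr)] with w hw0 hw1 hw i
  have hc : c ∈ Metric.ball c (r / 2) := Metric.mem_ball_self (half_pos hr)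
  have hmem : (u i c, u i w) ∈ Metric.closedBall (0 : ℂ) C ×ˢ Metric.closedBall (0 : ℂ) C :=
    ⟨mem_closedBall_zero_iff.2 (huC i c hc), mem_closedBall_zero_iff.2 (huC i w hw)⟩
  by_cases hi : ‖q i c‖ ≤ 1
  · have hT : ∀ z, ((a + (b - a) * u i z : ℂ) : OnePoint ℂ) = (h i z : OnePoint ℂ) := by
      intro z
      simp only [hu, hi, if_true]
      simp only [hq]
      rw [mul_div_cancel₀ _ hba, add_sub_cancel]
    have := hw0 i hmem
    simpa only [Set.mem_preimage, hT] using this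
  · have hT : ∀ z ∈ Metric.ball c r, Function.update
        (fun w : ℂ => ((a + (b - a) / w : ℂ) : OnePoint ℂ)) 0 ∞ (u i z) = (h i z : OnePoint ℂ) := by
      intro z hz
      have hne : u i z ≠ 0 := by
        simpa only [hu, hi, if_false] using inv_ne_zero (hq0 i z hz)
      rw [Function.update_of_ne hne]
      simp only [hu, hi, if_false]
      simp only [hq]
      rw [div_inv_eq_mul, mul_div_cancel₀ _ hba, add_sub_cancel]
    have := hw1 i hmem
    simpa only [Set.mem_preimage, hT c (hsub hc), hT w (hsub hw)] using this

theorem equicontinuousAt_of_isCompact_closure {X Y ι : Type*} [TopologicalSpace X]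
    [UniformSpace Y] [LocallyCompactSpace X] {u : ι → X → Y} {K : Set C(X, Y)} (hK : IsCompact K)
    (hu : ∀ i, ∃ k ∈ K, ∀ x, k x = u i x) (x : X) : EquicontinuousAt u x := by
  intro W hW
  have hev : ∀ k ∈ K, ∀ᶠ p : X × C(X, Y) in 𝓝 (x, k), (p.2 x, p.2 p.1) ∈ W := by
    intro k _
    have hc : Continuous fun p : X × C(X, Y) => (p.2 x, p.2 p.1) := by fun_prop
    refine hc.continuousAt.eventually_mem ?_
    rw [nhds_prod_eq]
    exact (nhds_prod_eq (x := k x) (y := k x) ▸ nhds_le_uniformity (k x)) hW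
  filter_upwards [hK.eventually_forall_of_forall_eventually
    (P := fun y k => (k x, k y) ∈ W) hev] with y hy i
  obtain ⟨k, hk, hki⟩ := hu i
  simpa only [hki] using hy k hk

theorem isCompact_closure_of_equicontinuous {X Y : Type*} [TopologicalSpace X]
    [LocallyCompactSpace X] [UniformSpace Y] [CompactSpace Y] [T2Space Y] {S : Set C(X, Y)}
    (hS : Equicontinuous ((↑) : S → X → Y)) : IsCompact (closure S) := by
  have hemb : IsClosedEmbedding (UniformOnFun.ofFun {K : Set X | IsCompact K} ∘
      (fun g : C(X, Y) => (g : X → Y))) := by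
    have h := ContinuousMap.isUniformEmbedding_toUniformOnFunIsCompact (α := X) (β := Y)
    have := UniformOnFun.t2Space_of_covering (α := X) (β := Y) (𝔖 := {K : Set X | IsCompact K})
      (Set.eq_univ_of_forall fun x => ⟨{x}, isCompact_singleton, rfl⟩)
    exact h.isClosedEmbedding
  refine ArzelaAscoli.isCompact_closure_of_isClosedEmbedding (fun K hK => hK) hemb
    (fun K _ => hS.equicontinuousOn K) fun K _ x _ => ⟨Set.univ, isCompact_univ, fun _ _ => trivial⟩

theorem exists_idempotent_ultrafilter_pnat : ∃ U : Ultrafilter ℕ+, ∀ P : ℕ+ → Prop,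
    (∀ᶠ n in U, P n) ↔ ∀ᶠ m in U, ∀ᶠ n in U, P (m + n) := by
  let _ := Ultrafilter.addSemigroup (M := ℕ+)
  obtain ⟨U, hU, -⟩ := Hindman.exists_idempotent_ultrafilter_le_FS (Stream'.const (1 : ℕ+))
  refine ⟨U, fun P => ?_⟩
  have h := Ultrafilter.eventually_add U U P
  rwa [show U + U = U from hU] at h

theorem differentiableAt_iterate_of_mapsTo {g : ℂ → ℂ} {p : ℂ} (hp : ∀ z ≠ p, g z ≠ p)
    (hd : ∀ z ≠ p, DifferentiableAt ℂ g z) (n : ℕ) :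
    ∀ z ≠ p, g^[n] z ≠ p ∧ DifferentiableAt ℂ g^[n] z := by
  induction n with
  | zero => exact fun z hz => ⟨hz, differentiableAt_id⟩
  | succ n ih =>
    intro z hz
    rw [Function.iterate_succ']
    exact ⟨hp _ (ih z hz).1, (hd _ (ih z hz).1).comp z (ih z hz).2⟩

theorem tendsto_coe_of_tendsto_norm_atTop {g : ℂ → ℂ} {l : Filter ℂ}
    (h : Tendsto (fun z => ‖g z‖) l atTop) : Tendsto (fun z => (g z : OnePoint ℂ)) l (𝓝 ∞) := by
  refine OnePoint.tendsto_coe_infty.comp ?_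
  rw [coclosedCompact_eq_cocompact, ← Metric.cobounded_eq_cocompact]
  exact tendsto_norm_atTop_iff_cobounded.1 h

theorem frequently_fixedPoint_of_mapsTo {g : ℂ → ℂ} {p : ℂ} (hp : ∀ z ≠ p, g z ≠ p)
    (hd : ∀ z ≠ p, DifferentiableAt ℂ g z)
    (hlim : ¬ ∃ L : OnePoint ℂ, Tendsto (fun z => (g z : OnePoint ℂ)) (cocompact ℂ) (𝓝 L)) :
    ∃ᶠ z in cocompact ℂ, g z = z := by
  intro hfix
  have hne : ∀ᶠ z in cocompact ℂ, z ≠ p := isCompact_singleton.compl_mem_cocompact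
  set k : ℂ → ℂ := fun z => (g z - p) / (z - p) with hk
  have hgk : ∀ z ≠ p, g z = p + k z * (z - p) := fun z hz => by
    rw [hk]; simp only
    rw [div_mul_cancel₀ _ (sub_ne_zero.2 hz), add_sub_cancel]
  obtain ⟨L, hL⟩ : ∃ L : OnePoint ℂ, Tendsto (fun z => (k z : OnePoint ℂ)) (cocompact ℂ) (𝓝 L) := by
    refine exists_tendsto_onePoint_of_omits (zero_ne_one' ℂ) ?_ ?_ ?_
    · filter_upwards [hne] with z hz
      exact ((hd z hz).sub_const p).div (differentiableAt_id.sub_const p) (sub_ne_zero.2 hz)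
    · filter_upwards [hne] with z hz
      exact div_ne_zero (sub_ne_zero.2 (hp z hz)) (sub_ne_zero.2 hz)
    · filter_upwards [hne, hfix] with z hz hf h1
      rw [hk] at h1
      simp only [div_eq_one_iff_eq (sub_ne_zero.2 hz), sub_left_inj] at h1
      exact hf h1
  by_cases hL0 : L = ((0 : ℂ) : OnePoint ℂ)
  · have hk0 : Tendsto k (cocompact ℂ) (𝓝 0) := by
      rw [OnePoint.isOpenEmbedding_coe.tendsto_nhds_iff]
      exact hL0 ▸ hL
    have hid : (fun z : ℂ => z - p) =O[cocompact ℂ] (id : ℂ → ℂ) := by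
      refine (Asymptotics.isBigO_refl _ _).sub ?_
      rw [← Metric.cobounded_eq_cocompact]
      exact (Asymptotics.isLittleO_const_id_cobounded p).isBigO
    have ho : g =o[cocompact ℂ] (id : ℂ → ℂ) := by
      have h1 : (fun z => p + k z * (z - p)) =o[cocompact ℂ] (id : ℂ → ℂ) := by
        refine Asymptotics.IsLittleO.add ?_ ?_
        · rw [← Metric.cobounded_eq_cocompact]
          exact Asymptotics.isLittleO_const_id_cobounded p
        · have := ((Asymptotics.isLittleO_one_iff ℂ).2 hk0).mul_isBigO hid
          simp only [one_mul] at this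
          exact this
      refine h1.congr' ?_ EventuallyEq.rfl
      filter_upwards [hne] with z hz using (hgk z hz).symm
    obtain ⟨L', hL'⟩ := exists_tendsto_cocompact_of_isLittleO (R := ‖p‖)
      (fun z hz => hd z (by rintro rfl; exact lt_irrefl _ hz)) ho
    exact hlim ⟨L', (OnePoint.continuous_coe.tendsto L').comp hL'⟩
  · obtain ⟨s, hs, t, ht, hst⟩ := Filter.disjoint_iff.1 (disjoint_nhds_nhds.2 hL0)
    rw [OnePoint.nhds_coe_eq, mem_map] at ht
    obtain ⟨ε, hε, hball⟩ := Metric.mem_nhds_iff.1 ht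
    refine hlim ⟨∞, tendsto_coe_of_tendsto_norm_atTop ?_⟩
    have hat : Tendsto (fun z : ℂ => ε * (‖z‖ - ‖p‖) - ‖p‖) (cocompact ℂ) atTop :=
      tendsto_atTop_add_const_right _ _ ((tendsto_atTop_add_const_right _ _
        (tendsto_norm_cocompact_atTop (E := ℂ))).const_mul_atTop hε)
    refine tendsto_atTop_mono' _ ?_ hat
    filter_upwards [hne, hL hs] with z hz hzs
    have hkz : ε ≤ ‖k z‖ := by
      by_contra hlt
      exact Set.disjoint_left.1 hst hzs (hball (mem_ball_zero_iff.2 (not_le.1 hlt)))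
    have h1 : ‖k z * (z - p)‖ - ‖p‖ ≤ ‖g z‖ := by
      have := norm_sub_norm_le (k z * (z - p)) (-p)
      rw [norm_neg, sub_neg_eq_add, add_comm (k z * _), ← hgk z hz] at this
      exact this
    rw [norm_mul] at h1
    nlinarith [norm_sub_norm_le z p, mul_le_mul hkz (le_refl ‖z - p‖) (norm_nonneg _) (norm_nonneg _)]

section LimitMap

variable {g : ℂ → ℂ} {p : ℂ} {U : Ultrafilter ℕ+} {φ : ℂ → OnePoint ℂ}

theorem exists_differentiableOn_ball_limit (hp : ∀ z ≠ p, g z ≠ p)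
    (hd : ∀ z ≠ p, DifferentiableAt ℂ g z)
    (heq : ∀ z ≠ p, EquicontinuousAt (fun (n : ℕ) w => (g^[n] w : OnePoint ℂ)) z)
    (hφ : ∀ z, Tendsto (fun n : ℕ+ => (g^[n] z : OnePoint ℂ)) U (𝓝 (φ z)))
    {z v : ℂ} (hz : z ≠ p) (hv : φ z = ↑v) :
    ∃ r > 0, ∃ k : ℂ → ℂ, DifferentiableOn ℂ k (Metric.ball z r) ∧
      ∀ w ∈ Metric.ball z r, φ w = ↑(k w) := by
  have hO : ((↑) '' Metric.ball v 1 : Set (OnePoint ℂ)) ∈ 𝓝 (v : OnePoint ℂ) := by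
    rw [OnePoint.nhds_coe_eq]
    exact image_mem_map (Metric.ball_mem_nhds v one_pos)
  obtain ⟨W, hW, hWO⟩ := UniformSpace.mem_nhds_iff.1 hO
  obtain ⟨W', hW', hWW⟩ := comp_mem_uniformity_sets hW
  obtain ⟨r, hr, hball⟩ := Metric.mem_nhds_iff.1
    (inter_mem (heq z hz W' hW') (isOpen_compl_singleton.mem_nhds hz))
  have hS : ∀ᶠ n : ℕ+ in U, ((v : OnePoint ℂ), (g^[n] z : OnePoint ℂ)) ∈ W' := by
    have := hφ z
    rw [hv] at this
    exact this (UniformSpace.ball_mem_nhds _ hW')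
  have hmem : ∀ n : ℕ+, ((v : OnePoint ℂ), (g^[n] z : OnePoint ℂ)) ∈ W' →
      ∀ w ∈ Metric.ball z r, g^[n] w ∈ Metric.ball v 1 := by
    intro n hn w hw
    obtain ⟨y, hy, hyw⟩ := hWO (hWW ⟨_, hn, (hball hw).1 n⟩)
    rwa [← OnePoint.coe_injective hyw]
  classical
  set u : ℕ+ → ℂ → ℂ := fun n =>
    if ((v : OnePoint ℂ), (g^[n] z : OnePoint ℂ)) ∈ W' then g^[n] else fun _ => 0 with hu
  have hlim : ∀ w ∈ Metric.ball z r, ∃ y : ℂ, Tendsto (fun n : ℕ+ => g^[n] w) U (𝓝 y) := by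
    intro w hw
    obtain ⟨y, -, hy⟩ := (isCompact_closedBall v 1).ultrafilter_le_nhds
      (U.map fun n : ℕ+ => g^[n] w) (tendsto_principal.2 (by
        filter_upwards [hS] with n hn
        exact Metric.ball_subset_closedBall (hmem n hn w hw)))
    exact ⟨y, hy⟩
  choose! k hk using hlim
  refine ⟨r, hr, k, ?_, fun w hw => tendsto_nhds_unique (hφ w)
    ((OnePoint.continuous_coe.tendsto _).comp (hk w hw))⟩
  refine differentiableOn_of_tendsto_of_forall_norm_le (l := (U : Filter ℕ+)) (u := u)
    (C := ‖v‖ + 1) ?_ ?_ ?_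
  · intro n
    by_cases hn : ((v : OnePoint ℂ), (g^[n] z : OnePoint ℂ)) ∈ W'
    · simp only [hu, hn, if_true]
      exact fun w hw =>
        (differentiableAt_iterate_of_mapsTo hp hd n w (hball hw).2).2.differentiableWithinAt
    · simp only [hu, hn, if_false]
      exact differentiableOn_const 0
  · intro n w hw
    by_cases hn : ((v : OnePoint ℂ), (g^[n] z : OnePoint ℂ)) ∈ W'
    · simp only [hu, hn, if_true]
      have := mem_ball_iff_norm.1 (hmem n hn w hw)
      linarith [norm_le_norm_add_norm_sub' (g^[n] w) v]
    · simp only [hu, hn, if_false, norm_zero]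
      positivity
  · intro w hw
    refine (hk w hw).congr' ?_
    filter_upwards [hS] with n hn
    simp only [hu, hn, if_true]

theorem limit_eq_self (hp : ∀ z ≠ p, g z ≠ p) (hd : ∀ z ≠ p, DifferentiableAt ℂ g z)
    (hU : ∀ P : ℕ+ → Prop, (∀ᶠ n in U, P n) ↔ ∀ᶠ m in U, ∀ᶠ n in U, P (m + n))
    (hφ : ∀ z, Tendsto (fun n : ℕ+ => (g^[n] z : OnePoint ℂ)) U (𝓝 (φ z)))
    {z v : ℂ} (hv : φ z = ↑v) (hvp : v ≠ p) : φ v = ↑v := by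
  refine tendsto_nhds_unique (hφ v) ?_
  rw [(closed_nhds_basis (v : OnePoint ℂ)).tendsto_right_iff]
  rintro N ⟨hN, hNc⟩
  have hzv : Tendsto (fun n : ℕ+ => g^[n] z) U (𝓝 v) := by
    rw [OnePoint.isOpenEmbedding_coe.tendsto_nhds_iff]
    exact hv ▸ hφ z
  have h1 : ∀ᶠ n : ℕ+ in U, (g^[n] z : OnePoint ℂ) ∈ N := hφ z (by rwa [hv])
  rw [hU] at h1
  filter_upwards [h1] with m hm
  have h2 : Tendsto (fun n : ℕ+ => (g^[m] (g^[n] z) : OnePoint ℂ)) U (𝓝 (g^[m] v : OnePoint ℂ)) :=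
    (OnePoint.continuous_coe.tendsto _).comp
      ((differentiableAt_iterate_of_mapsTo hp hd m v hvp).2.continuousAt.tendsto.comp hzv)
  refine hNc.mem_of_tendsto h2 ?_
  filter_upwards [hm] with n hn
  rwa [PNat.add_coe, Function.iterate_add_apply] at hn

theorem continuousAt_limit
    (heq : ∀ z ≠ p, EquicontinuousAt (fun (n : ℕ) w => (g^[n] w : OnePoint ℂ)) z)
    (hφ : ∀ z, Tendsto (fun n : ℕ+ => (g^[n] z : OnePoint ℂ)) U (𝓝 (φ z)))
    {z : ℂ} (hz : z ≠ p) : ContinuousAt φ z := by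
  refine Filter.Tendsto.continuousAt_of_equicontinuousAt (l := (U : Filter ℕ+))
    (F := fun (n : ℕ+) w => (g^[n] w : OnePoint ℂ)) (tendsto_pi_nhds.2 hφ) ?_
  exact fun W hW => (heq z hz W hW).mono fun w hw n => hw n

theorem limit_eq_of_eventually_eq (hp : ∀ z ≠ p, g z ≠ p) (hd : ∀ z ≠ p, DifferentiableAt ℂ g z)
    (heq : ∀ z ≠ p, EquicontinuousAt (fun (n : ℕ) w => (g^[n] w : OnePoint ℂ)) z)
    (hφ : ∀ z, Tendsto (fun n : ℕ+ => (g^[n] z : OnePoint ℂ)) U (𝓝 (φ z)))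
    {k : ℂ → ℂ} (hk : Differentiable ℂ k) {a : ℂ} (ha : a ≠ p) (hak : ∀ᶠ w in 𝓝 a, φ w = ↑(k w))
    {z : ℂ} (hz : z ≠ p) : φ z = ↑(k z) := by
  have hpre : IsPreconnected ({p}ᶜ : Set ℂ) :=
    (isConnected_compl_singleton_of_one_lt_rank (by simp) p).isPreconnected
  have hsub : ({p}ᶜ : Set ℂ) ⊆ {z | ∀ᶠ w in 𝓝 z, φ w = ↑(k w)} := by
    refine hpre.subset_of_closure_inter_subset ?_ ⟨a, ha, hak⟩ ?_
    · exact isOpen_setOfPred_eventually_nhds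
    · rintro z ⟨hzc, hzp⟩
      have hfr := mem_closure_iff_frequently.1 hzc
      have hzk : φ z = ↑(k z) :=
        tendsto_nhds_unique_of_frequently_eq (continuousAt_limit heq hφ hzp)
          (OnePoint.continuous_coe.continuousAt.comp hk.continuous.continuousAt)
          (hfr.mono fun w hw => hw.self_of_nhds)
      obtain ⟨r, hr, k', hk', hφk'⟩ := exists_differentiableOn_ball_limit hp hd heq hφ hzp hzk
      obtain ⟨w, hw, hwr⟩ := (hfr.and_eventually (Metric.ball_mem_nhds z hr)).exists
      have hwn := Metric.isOpen_ball.mem_nhds hwr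
      have heqw : k' =ᶠ[𝓝 w] k := by
        filter_upwards [hw, hwn] with y hy hyr
        exact OnePoint.coe_injective ((hφk' y hyr).symm.trans hy)
      have hEq := (hk'.analyticOnNhd Metric.isOpen_ball).eqOn_of_preconnected_of_eventuallyEq
        (hk.differentiableOn.analyticOnNhd Metric.isOpen_ball)
        (convex_ball z r).isPreconnected hwr heqw
      filter_upwards [Metric.ball_mem_nhds z hr] with y hy
      rw [hφk' y hy, hEq hy]
  exact (hsub hz).self_of_nhds

end LimitMap

/-- A holomorphic self-map of a once punctured plane with an essential singularity at `∞` does not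
have an equicontinuous family of iterates. -/
theorem false_of_equicontinuousAt_iterate {g : ℂ → ℂ} {p : ℂ} (hp : ∀ z ≠ p, g z ≠ p)
    (hd : ∀ z ≠ p, DifferentiableAt ℂ g z)
    (hlim : ¬ ∃ L : OnePoint ℂ, Tendsto (fun z => (g z : OnePoint ℂ)) (cocompact ℂ) (𝓝 L))
    (heq : ∀ z ≠ p, EquicontinuousAt (fun (n : ℕ) w => (g^[n] w : OnePoint ℂ)) z) : False := by
  have hfix := frequently_fixedPoint_of_mapsTo hp hd hlim
  have hne : ∀ q : ℂ, ∀ᶠ z in cocompact ℂ, z ≠ q := fun q => isCompact_singleton.compl_mem_cocompact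
  obtain ⟨a, ha, hap⟩ := (hfix.and_eventually (hne p)).exists
  obtain ⟨b, hb, hbp, hba⟩ := (hfix.and_eventually ((hne p).and (hne a))).exists
  obtain ⟨U, hU⟩ := exists_idempotent_ultrafilter_pnat
  have hex : ∀ z, ∃ y, Tendsto (fun n : ℕ+ => (g^[n] z : OnePoint ℂ)) U (𝓝 y) := fun z => by
    obtain ⟨y, -, hy⟩ := isCompact_univ.ultrafilter_le_nhds
      (U.map fun n : ℕ+ => (g^[n] z : OnePoint ℂ)) (by simp)
    exact ⟨y, hy⟩
  choose φ hφ using hex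
  have hfixφ : ∀ c, g c = c → φ c = ↑c := fun c hc => by
    refine tendsto_nhds_unique (hφ c) ?_
    have : ∀ n : ℕ+, g^[n] c = c := fun n => Function.iterate_fixed hc n
    simp only [this]
    exact tendsto_const_nhds
  obtain ⟨r, hr, k, hk, hφk⟩ := exists_differentiableOn_ball_limit hp hd heq hφ hap (hfixφ a ha)
  have hka : k a = a := OnePoint.coe_injective
    ((hφk a (Metric.mem_ball_self hr)).symm.trans (hfixφ a ha))
  have hkan : AnalyticAt ℂ k a :=
    hk.analyticOnNhd Metric.isOpen_ball a (Metric.mem_ball_self hr)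
  rcases hkan.eventually_constant_or_nhds_le_map_nhds with hconst | hopen
  · have hev : ∀ᶠ w in 𝓝 a, φ w = ↑((fun _ => a) w : ℂ) := by
      filter_upwards [hconst, Metric.ball_mem_nhds a hr] with w hw hwr
      rw [hφk w hwr, hw, hka]
    have := limit_eq_of_eventually_eq hp hd heq hφ (differentiable_const a) hap hev hbp
    rw [hfixφ b hb] at this
    exact hba (OnePoint.coe_injective this)
  · rw [hka] at hopen
    have hev : ∀ᶠ w in 𝓝 a, φ w = ↑(id w : ℂ) := by
      refine hopen (mem_map.2 ?_)
      have hkp : ∀ᶠ w in 𝓝 a, k w ≠ p :=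
        hkan.continuousAt.eventually_ne (by rwa [hka])
      filter_upwards [hkp, Metric.ball_mem_nhds a hr] with w hw hwr
      exact limit_eq_self hp hd hU hφ (hφk w hwr) hw
    have hid : ∀ z ≠ p, φ z = ↑z := fun z hz =>
      limit_eq_of_eventually_eq hp hd heq hφ differentiable_id hap hev hz
    have hinj : ∀ z ≠ p, ∀ w ≠ p, g z = g w → z = w := by
      intro z hz w hw hzw
      refine OnePoint.coe_injective ((hid z hz).symm.trans (Eq.trans ?_ (hid w hw)))
      refine tendsto_nhds_unique (hφ z) ((hφ w).congr fun n => ?_)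
      rw [← Nat.succ_pred_eq_of_pos n.pos, Function.iterate_succ_apply, Function.iterate_succ_apply,
        hzw]
    refine hlim (exists_tendsto_onePoint_of_omits (a := g a) (b := g b) ?_ ?_ ?_ ?_)
    · exact fun h => hba (hinj a hap b hbp h).symm
    · filter_upwards [hne p] with z hz using hd z hz
    · filter_upwards [hne p, hne a] with z hz hza h using hza (hinj z hz a hap h)
    · filter_upwards [hne p, hne b] with z hz hzb h using hzb (hinj z hz b hbp h)

/-- The complex number underlying a point of the Riemann sphere, with value `0` at `∞`. -/
noncomputable def finitePart (x : OnePoint ℂ) : ℂ := x.elim 0 id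

@[simp] theorem finitePart_coe (z : ℂ) : finitePart z = z := rfl

theorem coe_finitePart {x : OnePoint ℂ} (hx : x ≠ ∞) : (finitePart x : OnePoint ℂ) = x := by
  obtain ⟨z, rfl⟩ := OnePoint.ne_infty_iff_exists.1 hx
  rfl

theorem continuousAt_finitePart {x : OnePoint ℂ} (hx : x ≠ ∞) : ContinuousAt finitePart x := by
  obtain ⟨z, rfl⟩ := OnePoint.ne_infty_iff_exists.1 hx
  rw [OnePoint.continuousAt_coe]
  exact continuousAt_id

theorem analyticAt_finitePart_comp {f : ℂ → OnePoint ℂ} {z : ℂ} (hcont : ContinuousAt f z)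
    (hmero : ∃ g : ℂ → ℂ, MeromorphicAt g z ∧ ∀ᶠ w in 𝓝[≠] z, f w = ↑(g w)) (hz : f z ≠ ∞) :
    AnalyticAt ℂ (fun w => finitePart (f w)) z := by
  obtain ⟨g, hg, hfg⟩ := hmero
  refine MeromorphicAt.analyticAt (hg.congr ?_)
    (ContinuousAt.comp (g := finitePart) (continuousAt_finitePart hz) hcont)
  filter_upwards [hfg] with w hw
  rw [hw, finitePart_coe]

theorem mem_backOrbitInfty {F : OnePoint ℂ → OnePoint ℂ} {x : OnePoint ℂ} :
    x ∈ backOrbitInfty F ↔ ∃ m : ℕ, F^[m] x = ∞ := by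
  simp [backOrbitInfty]

theorem infty_mem_backOrbitInfty (F : OnePoint ℂ → OnePoint ℂ) : ∞ ∈ backOrbitInfty F :=
  mem_backOrbitInfty.2 ⟨0, rfl⟩

theorem iterate_ne_infty {F : OnePoint ℂ → OnePoint ℂ} {x : OnePoint ℂ} (hx : x ∉ backOrbitInfty F)
    (n : ℕ) : F^[n] x ≠ ∞ := fun h => hx (mem_backOrbitInfty.2 ⟨n, h⟩)

theorem iterate_notMem_backOrbitInfty {F : OnePoint ℂ → OnePoint ℂ} {x : OnePoint ℂ}
    (hx : x ∉ backOrbitInfty F) (n : ℕ) : F^[n] x ∉ backOrbitInfty F := by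
  rw [mem_backOrbitInfty]
  rintro ⟨m, hm⟩
  rw [← Function.iterate_add_apply] at hm
  exact iterate_ne_infty hx _ hm

theorem eventually_nhds_coe {z : ℂ} {Q : OnePoint ℂ → Prop} :
    (∀ᶠ x in 𝓝 (z : OnePoint ℂ), Q x) ↔ ∀ᶠ w : ℂ in 𝓝 z, Q w := by
  rw [OnePoint.nhds_coe_eq, eventually_map]

section Dynamics

variable {f : ℂ → OnePoint ℂ} {F : OnePoint ℂ → OnePoint ℂ}

theorem analyticAt_continuousAt_iterate (hFf : ∀ z : ℂ, F ↑z = f z) (hcont : Continuous f)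
    (hmero : ∀ z : ℂ, ∃ g : ℂ → ℂ, MeromorphicAt g z ∧ ∀ᶠ w in 𝓝[≠] z, f w = ↑(g w))
    (n : ℕ) {z : ℂ} (hz : ↑z ∉ backOrbitInfty F) :
    AnalyticAt ℂ (fun w : ℂ => finitePart (F^[n] w)) z ∧ ContinuousAt F^[n] (z : OnePoint ℂ) := by
  induction n with
  | zero => exact ⟨analyticAt_id, continuousAt_id⟩
  | succ n ih =>
    obtain ⟨ha, hc⟩ := ih
    set v := finitePart (F^[n] z) with hv
    have hvz : (v : OnePoint ℂ) = F^[n] z := coe_finitePart (iterate_ne_infty hz n)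
    have hfv : f v ≠ ∞ := by
      rw [← hFf, hvz, ← Function.iterate_succ_apply' F]
      exact iterate_ne_infty hz (n + 1)
    have hFv : ContinuousAt F (v : OnePoint ℂ) := by
      rw [OnePoint.continuousAt_coe]
      exact (funext hFf : F ∘ ((↑) : ℂ → OnePoint ℂ) = f) ▸ hcont.continuousAt
    simp only [Function.iterate_succ']
    refine ⟨?_, ContinuousAt.comp (hvz ▸ hFv) hc⟩
    have hcomp : AnalyticAt ℂ ((fun w => finitePart (f w)) ∘ fun w : ℂ => finitePart (F^[n] w)) z :=
      AnalyticAt.comp (analyticAt_finitePart_comp hcont.continuousAt (hmero v) hfv) ha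
    refine hcomp.congr ?_
    filter_upwards [eventually_nhds_coe.1 (hc.eventually_ne (iterate_ne_infty hz n))] with w hw
    simp only [Function.comp_apply, ← hFf, coe_finitePart hw]

theorem mem_fatouSet_iff (hFf : ∀ z : ℂ, F ↑z = f z) (hcont : Continuous f)
    (hmero : ∀ z : ℂ, ∃ g : ℂ → ℂ, MeromorphicAt g z ∧ ∀ᶠ w in 𝓝[≠] z, f w = ↑(g w))
    {x : OnePoint ℂ} : x ∈ fatouSet F ↔ ∃ V : Set (OnePoint ℂ), IsOpen V ∧ x ∈ V ∧
      (∀ z ∈ V, z ∉ backOrbitInfty F) ∧ ∀ z ∈ V, EquicontinuousAt (fun n => F^[n]) z := by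
  have hdef : ∀ V, IterDefinedOn F V ↔ ∀ z ∈ V, z ∉ backOrbitInfty F := fun V => by
    simp only [IterDefinedOn, mem_backOrbitInfty, not_exists]
  have hev : ∀ {V : Set (OnePoint ℂ)}, IsOpen V → ∀ (z : V) (Q : OnePoint ℂ → Prop),
      (∀ᶠ y in 𝓝 (z : OnePoint ℂ), Q y) ↔ ∀ᶠ y : V in 𝓝 z, Q y := fun hV z Q => by
    rw [← hV.isOpenEmbedding_subtypeVal.map_nhds_eq z, eventually_map]
  constructor
  · rintro ⟨V, hV, hxV, hVd, hVn⟩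
    rw [hdef] at hVd
    refine ⟨V, hV, hxV, hVd, fun z hz W hW => ?_⟩
    have : LocallyCompactSpace V := hV.locallyCompactSpace
    have hceq : ∀ n, Continuous fun y : V => F^[n] y := by
      refine fun n => continuous_iff_continuousAt.2 fun y => ?_
      obtain ⟨w, hw⟩ := OnePoint.ne_infty_iff_exists.1 (iterate_ne_infty (hVd y y.2) 0)
      have hwy : (w : OnePoint ℂ) = y := hw
      have := (analyticAt_continuousAt_iterate hFf hcont hmero n (hwy ▸ hVd y y.2)).2
      exact ContinuousAt.comp (g := F^[n]) (hwy ▸ this) continuousAt_subtype_val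
    have := equicontinuousAt_of_isCompact_closure hVn (u := fun (n : ℕ) (y : V) => F^[n] y)
      (fun n => ⟨⟨_, hceq n⟩, subset_closure ⟨n, fun _ => rfl⟩, fun _ => rfl⟩) ⟨z, hz⟩ W hW
    exact (hev hV ⟨z, hz⟩ _).2 this
  · rintro ⟨V, hV, hxV, hVd, hVe⟩
    refine ⟨V, hV, hxV, (hdef V).2 hVd, ?_⟩
    have : LocallyCompactSpace V := hV.locallyCompactSpace
    refine isCompact_closure_of_equicontinuous fun z W hW => ?_
    filter_upwards [(hev hV z _).1 (hVe z z.2 W hW)] with y hy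
    rintro ⟨k, n, hn⟩
    have h := hy n
    rwa [← hn z, ← hn y] at h

theorem mem_fatouSet_of_infinite_compl (hFf : ∀ z : ℂ, F ↑z = f z) (hcont : Continuous f)
    (hmero : ∀ z : ℂ, ∃ g : ℂ → ℂ, MeromorphicAt g z ∧ ∀ᶠ w in 𝓝[≠] z, f w = ↑(g w))
    {x : OnePoint ℂ} {U : Set (OnePoint ℂ)} (hU : U ∈ 𝓝 x) (hUE : ∀ z ∈ U, z ∉ backOrbitInfty F)
    (hinf : (⋃ m : ℕ, F^[m] '' U)ᶜ.Infinite) : x ∈ fatouSet F := by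
  have hx : x ≠ ∞ := fun h => hUE x (mem_of_mem_nhds hU) (h ▸ infty_mem_backOrbitInfty F)
  obtain ⟨c, rfl⟩ := OnePoint.ne_infty_iff_exists.1 hx
  obtain ⟨p, ⟨hp, hp'⟩, q, ⟨hq, hq'⟩, hpq⟩ := (hinf.sdiff (Set.finite_singleton ∞)).nontrivial
  obtain ⟨a, rfl⟩ := OnePoint.ne_infty_iff_exists.1 hp'
  obtain ⟨b, rfl⟩ := OnePoint.ne_infty_iff_exists.1 hq'
  rw [OnePoint.nhds_coe_eq, mem_map] at hU
  obtain ⟨r, hr, hball⟩ := Metric.mem_nhds_iff.1 hU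
  have hcoe : ∀ w ∈ Metric.ball c r, ∀ n, (finitePart (F^[n] w) : OnePoint ℂ) = F^[n] w :=
    fun w hw n => coe_finitePart (iterate_ne_infty (hUE w (hball hw)) n)
  have homit : ∀ y : ℂ, (y : OnePoint ℂ) ∈ (⋃ m : ℕ, F^[m] '' U)ᶜ → ∀ n, ∀ w ∈ Metric.ball c r,
      finitePart (F^[n] w) ≠ y := by
    rintro y hy n w hw rfl
    exact hy (Set.mem_iUnion.2 ⟨n, w, hball hw, (hcoe w hw n).symm⟩)
  rw [mem_fatouSet_iff hFf hcont hmero]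
  refine ⟨(↑) '' Metric.ball c r, OnePoint.isOpenEmbedding_coe.isOpenMap _ Metric.isOpen_ball,
    ⟨c, Metric.mem_ball_self hr, rfl⟩, ?_, ?_⟩
  · rintro _ ⟨w, hw, rfl⟩
    exact hUE w (hball hw)
  · rintro _ ⟨w, hw, rfl⟩ W hW
    obtain ⟨ρ, hρ, hsub⟩ := Metric.isOpen_iff.1 Metric.isOpen_ball w hw
    have hM := equicontinuousAt_coe_of_omits (h := fun (n : ℕ) (w : ℂ) => finitePart (F^[n] w)) hρ
      (fun h : a = b => hpq (congrArg _ h))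
      (fun n y hy => (analyticAt_continuousAt_iterate hFf hcont hmero n
        (hUE y (hball (hsub hy)))).1.differentiableAt.differentiableWithinAt)
      (fun n y hy => homit a hp n y (hsub hy)) (fun n y hy => homit b hq n y (hsub hy))
    refine eventually_nhds_coe.2 ?_
    filter_upwards [hM W hW, Metric.ball_mem_nhds w hρ] with y hy hyρ n
    have h := hy n
    rwa [hcoe w hw, hcoe y (hsub hyρ)] at h

theorem isOpen_image_of_finite_backOrbit (hFf : ∀ z : ℂ, F ↑z = f z) (hcont : Continuous f)
    (hmero : ∀ z : ℂ, ∃ g : ℂ → ℂ, MeromorphicAt g z ∧ ∀ᶠ w in 𝓝[≠] z, f w = ↑(g w))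
    (htrans : ¬ ∃ L : OnePoint ℂ, Tendsto f (Filter.cocompact ℂ) (𝓝 L))
    (hE : (backOrbitInfty F).Finite) {V : Set (OnePoint ℂ)} (hV : IsOpen V)
    (hVE : ∀ z ∈ V, z ∉ backOrbitInfty F) : IsOpen (F '' V) := by
  set Ω : Set ℂ := {z | (z : OnePoint ℂ) ∉ backOrbitInfty F} with hΩ
  have hfin : (Ωᶜ).Finite := by
    refine (hE.preimage (OnePoint.coe_injective.injOn)).subset fun z hz => ?_
    exact not_not.1 hz
  have hfΩ : ∀ z ∈ Ω, f z ≠ ∞ := fun z hz => by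
    rw [← hFf]; exact iterate_ne_infty hz 1
  have hpre : IsPreconnected Ω := by
    have := hfin.countable.isPathConnected_compl_of_one_lt_rank (by simp)
    rw [compl_compl] at this
    exact this.isConnected.isPreconnected
  have han : AnalyticOnNhd ℂ (fun w => finitePart (f w)) Ω := fun z hz =>
    analyticAt_finitePart_comp hcont.continuousAt (hmero z) (hfΩ z hz)
  rcases han.is_constant_or_isOpen hpre with ⟨w, hw⟩ | hopen
  · refine absurd ⟨(w : OnePoint ℂ), ?_⟩ htrans
    refine tendsto_const_nhds.congr' ?_
    filter_upwards [hfin.isCompact.compl_mem_cocompact] with z hz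
    rw [compl_compl] at hz
    rw [← hw z hz, coe_finitePart (hfΩ z hz)]
  · have hVΩ : ((↑) ⁻¹' V : Set ℂ) ⊆ Ω := fun z hz => hVE z hz
    have himg : F '' V = (↑) '' ((fun w => finitePart (f w)) '' ((↑) ⁻¹' V : Set ℂ)) := by
      ext y
      constructor
      · rintro ⟨x, hx, rfl⟩
        obtain ⟨z, rfl⟩ := OnePoint.ne_infty_iff_exists.1 (iterate_ne_infty (hVE x hx) 0)
        refine ⟨_, ⟨z, hx, rfl⟩, ?_⟩
        simp only [coe_finitePart (hfΩ z (hVΩ hx))]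
        exact (hFf z).symm
      · rintro ⟨_, ⟨z, hz, rfl⟩, rfl⟩
        refine ⟨z, hz, ?_⟩
        simp only [coe_finitePart (hfΩ z (hVΩ hz)), hFf]
    rw [himg]
    exact OnePoint.isOpenEmbedding_coe.isOpenMap _
      (hopen _ hVΩ (hV.preimage OnePoint.continuous_coe))

theorem apply_mem_fatouSet_of_finite_backOrbit (hFf : ∀ z : ℂ, F ↑z = f z) (hcont : Continuous f)
    (hmero : ∀ z : ℂ, ∃ g : ℂ → ℂ, MeromorphicAt g z ∧ ∀ᶠ w in 𝓝[≠] z, f w = ↑(g w))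
    (htrans : ¬ ∃ L : OnePoint ℂ, Tendsto f (Filter.cocompact ℂ) (𝓝 L))
    (hE : (backOrbitInfty F).Finite) {x : OnePoint ℂ} (hx : x ∈ fatouSet F) :
    F x ∈ fatouSet F := by
  rw [mem_fatouSet_iff hFf hcont hmero] at hx ⊢
  obtain ⟨V, hV, hxV, hVE, hVe⟩ := hx
  have himg : ∀ {A : Set (OnePoint ℂ)}, IsOpen A → A ⊆ V → IsOpen (F '' A) := fun hA hAV =>
    isOpen_image_of_finite_backOrbit hFf hcont hmero htrans hE hA fun z hz => hVE z (hAV hz)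
  refine ⟨F '' V, himg hV subset_rfl, ⟨x, hxV, rfl⟩, ?_, ?_⟩
  · rintro _ ⟨z, hz, rfl⟩
    exact iterate_notMem_backOrbitInfty (hVE z hz) 1
  · rintro _ ⟨z, hz, rfl⟩ W hW
    obtain ⟨A, hA, hAo, hzA⟩ := mem_nhds_iff.1 (inter_mem (hVe z hz W hW) (hV.mem_nhds hz))
    filter_upwards [(himg hAo fun y hy => (hA hy).2).mem_nhds ⟨z, hzA, rfl⟩]
    rintro _ ⟨y, hy, rfl⟩ n
    exact (hA hy).1 (n + 1)

theorem not_finite_compl_fatouSet (hFf : ∀ z : ℂ, F ↑z = f z) (hcont : Continuous f)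
    (hmero : ∀ z : ℂ, ∃ g : ℂ → ℂ, MeromorphicAt g z ∧ ∀ᶠ w in 𝓝[≠] z, f w = ↑(g w))
    (htrans : ¬ ∃ L : OnePoint ℂ, Tendsto f (Filter.cocompact ℂ) (𝓝 L))
    (hpole : ∃ z : ℂ, f z = ∞) (hE : (backOrbitInfty F).Finite) : ¬ (fatouSet F)ᶜ.Finite := by
  intro hJ
  have hnotE : ∀ x ∈ fatouSet F, x ∉ backOrbitInfty F := fun x hx => by
    obtain ⟨V, -, hxV, hVE, -⟩ := (mem_fatouSet_iff hFf hcont hmero).1 hx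
    exact hVE x hxV
  set P : Set ℂ := {z | (z : OnePoint ℂ) ∈ (fatouSet F)ᶜ} with hP
  have hPfin : P.Finite := hJ.preimage OnePoint.coe_injective.injOn
  have hPev : ∀ᶠ z in cocompact ℂ, z ∉ P := hPfin.isCompact.compl_mem_cocompact
  set g : ℂ → ℂ := fun w => finitePart (f w) with hg
  have hfg : ∀ z ∉ P, (g z : OnePoint ℂ) = F z := fun z hz => by
    rw [hg]; simp only
    rw [← hFf]
    exact coe_finitePart (iterate_ne_infty (hnotE _ (not_not.1 hz)) 1)
  have hgP : ∀ z ∉ P, g z ∉ P := fun z hz => by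
    refine not_not.2 ?_
    rw [hfg z hz]
    exact apply_mem_fatouSet_of_finite_backOrbit hFf hcont hmero htrans hE (not_not.1 hz)
  have hgd : ∀ z ∉ P, DifferentiableAt ℂ g z := fun z hz => by
    refine (analyticAt_finitePart_comp hcont.continuousAt (hmero z) ?_).differentiableAt
    rw [← hFf]
    exact iterate_ne_infty (hnotE _ (not_not.1 hz)) 1
  have hglim : ¬ ∃ L : OnePoint ℂ, Tendsto (fun z => (g z : OnePoint ℂ)) (cocompact ℂ) (𝓝 L) := by
    rintro ⟨L, hL⟩
    refine htrans ⟨L, hL.congr' ?_⟩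
    filter_upwards [hPev] with z hz
    rw [hfg z hz, hFf]
  obtain ⟨p, hp⟩ := hpole
  have hpP : p ∈ P := fun h => hnotE _ h (mem_backOrbitInfty.2 ⟨1, by rw [← hp, ← hFf]; rfl⟩)
  have hPp : ∀ q ∈ P, q = p := by
    intro q hq
    by_contra hqp
    refine hglim (exists_tendsto_onePoint_of_omits hqp ?_ ?_ ?_)
    · filter_upwards [hPev] with z hz using hgd z hz
    · filter_upwards [hPev] with z hz h using hgP z hz (h ▸ hq)
    · filter_upwards [hPev] with z hz h using hgP z hz (h ▸ hpP)
  have hnotP : ∀ {z : ℂ}, z ≠ p → z ∉ P := fun hz h => hz (hPp _ h)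
  refine false_of_equicontinuousAt_iterate (g := g) (p := p)
    (fun z hz h => hgP z (hnotP hz) (h ▸ hpP)) (fun z hz => hgd z (hnotP hz)) hglim ?_
  intro z hz W hW
  have hiter : ∀ (n : ℕ), ∀ w ∉ P, g^[n] w ∉ P ∧ (g^[n] w : OnePoint ℂ) = F^[n] w := by
    intro n w hw
    induction n with
    | zero => exact ⟨hw, rfl⟩
    | succ n ih =>
      rw [Function.iterate_succ_apply', Function.iterate_succ_apply']
      exact ⟨hgP _ ih.1, by rw [hfg _ ih.1, ih.2]⟩
  obtain ⟨V, -, hzV, -, hVe⟩ := (mem_fatouSet_iff hFf hcont hmero).1 (not_not.1 (hnotP hz))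
  filter_upwards [eventually_nhds_coe.1 (hVe _ hzV W hW), isOpen_ne.mem_nhds hz] with w hw hwp n
  rw [(hiter n z (hnotP hz)).2, (hiter n w (hnotP hwp)).2]
  exact hw n

end Dynamics

end Sphere

theorem stmt2 (f : ℂ → OnePoint ℂ) (F : OnePoint ℂ → OnePoint ℂ)
    (hFinfty : F ∞ = ∞) (hFf : ∀ z : ℂ, F ↑z = f z)
    (hcont : Continuous f)
    (hmero : ∀ z : ℂ, ∃ g : ℂ → ℂ, MeromorphicAt g z ∧ ∀ᶠ w in 𝓝[≠] z, f w = ↑(g w))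
    (htrans : ¬ ∃ L : OnePoint ℂ, Tendsto f (Filter.cocompact ℂ) (𝓝 L))
    (hpole : ∃ z : ℂ, f z = ∞) :
    (fatouSet F)ᶜ =
      {x | x ∉ closure (backOrbitInfty F) ∧
          ∀ U ∈ 𝓝 x, U ⊆ (closure (backOrbitInfty F))ᶜ →
            ((⋃ m : ℕ, F^[m] '' U)ᶜ).Finite}
        ∪ closure (backOrbitInfty F) := by
  have hdisj : ∀ x ∈ fatouSet F, x ∉ closure (backOrbitInfty F) := by
    intro x hx hxE
    obtain ⟨V, hV, hxV, hVE, -⟩ := (mem_fatouSet_iff hFf hcont hmero).1 hx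
    obtain ⟨y, hyV, hyE⟩ := mem_closure_iff.1 hxE V hV hxV
    exact hVE y hyV hyE
  refine Set.Subset.antisymm (fun x hx => ?_) (Set.union_subset ?_ fun x hxE hx => hdisj x hx hxE)
  · by_cases hxE : x ∈ closure (backOrbitInfty F)
    · exact Or.inr hxE
    · refine Or.inl ⟨hxE, fun U hU hUE => ?_⟩
      by_contra hinf
      exact hx (mem_fatouSet_of_infinite_compl hFf hcont hmero hU
        (fun z hz h => hUE hz (subset_closure h)) hinf)
  · rintro x ⟨hxE, hfin⟩ hx
    have hE : (backOrbitInfty F).Finite := by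
      refine (hfin _ (isClosed_closure.isOpen_compl.mem_nhds hxE) subset_rfl).subset ?_
      intro y hy hyU
      obtain ⟨m, z, hz, rfl⟩ := Set.mem_iUnion.1 hyU
      exact iterate_notMem_backOrbitInfty (fun h => hz (subset_closure h)) m hy
    refine not_finite_compl_fatouSet hFf hcont hmero htrans hpole hE ?_
    obtain ⟨V, hV, hxV, hVE⟩ := (mem_fatouSet_iff hFf hcont hmero).1 hx
    have hVfat : V ⊆ fatouSet F := fun z hz =>
      (mem_fatouSet_iff hFf hcont hmero).2 ⟨V, hV, hz, hVE⟩
    refine (hfin V (hV.mem_nhds hxV) fun z hz => hdisj z (hVfat hz)).subset ?_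
    refine Set.compl_subset_compl.2 (Set.iUnion_subset fun m => ?_)
    rintro _ ⟨z, hz, rfl⟩
    induction m with
    | zero => exact hVfat hz
    | succ m ih =>
      rw [Function.iterate_succ_apply']
      exact apply_mem_fatouSet_of_finite_backOrbit hFf hcont hmero htrans hE ih
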